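/- Let 1 < p < ∞. Let v and w be non-negative real-valued functions on ℕ = {1,2,...} and let φ : ℕ₀ → [0,∞) be positive and non-decreasing on ℕ with φ(0) = 0, such that for every n ≥ 1 the equality v(n)·(φ(n) − φ(n−1))^{p−1} − v(n+1)·(φ(n+1) − φ(n))^{p−1} = w(n)·φ(n)^{p−1} holds. Then for every finitely supported sequence u : ℕ₀ → ℂ with u(0) = 0, one has the identity ∑_{n=1}^∞ v(n)|u(n) − u(n−1)|^p = ∑_{n=1}^∞ w(n)|u(n)|^p + ∑_{n=2}^∞ v(n)·R_p(u(n), φ(n)). -/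

import Mathlib

open Complex

/-- The `C_p`-functional: `C_p(ξ,η) = |ξ|^p - |ξ-η|^p - p|ξ-η|^{p-2} Re((ξ-η)·conj η)`. -/
noncomputable def Cp (p : ℝ) (ξ η : ℂ) : ℝ :=
  ‖ξ‖ ^ p - ‖ξ - η‖ ^ p - p * ‖ξ - η‖ ^ (p - 2) * ((ξ - η) * (starRingEnd ℂ) η).re

/-- The remainder term `R_p(u(n), φ(n))` (used for `n ≥ 2`). -/
noncomputable def Rp (p : ℝ) (φ : ℕ → ℝ) (u : ℕ → ℂ) (n : ℕ) : ℝ :=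
  Cp p (u n - u (n - 1)) (((φ (n - 1) / φ n : ℝ) : ℂ) * u n - u (n - 1))
    + φ (n - 1) * (φ n - φ (n - 1)) ^ (p - 1) *
      Cp p (u (n - 1) / ((φ (n - 1) : ℝ) : ℂ))
        (u (n - 1) / ((φ (n - 1) : ℝ) : ℂ) - u n / ((φ n : ℝ) : ℂ))

/-- `C_p` when `ξ - η` is a non-negative real multiple of `x`. -/
lemma Cp_of_sub_eq_real_mul {p r : ℝ} (hp : 1 < p) (hr : 0 ≤ r) {ξ η x : ℂ}
    (h : ξ - η = (r : ℂ) * x) :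
    Cp p ξ η = ‖ξ‖ ^ p - r ^ (p - 1) * r * ‖x‖ ^ p
      - p * r ^ (p - 1) * ‖x‖ ^ (p - 2) * (x * (starRingEnd ℂ) η).re := by
  have hmul : r ^ (p - 2) * r = r ^ (p - 1) := by
    rw [← Real.rpow_add_one' hr (by linarith)]
    ring_nf
  have hmul' : r ^ (p - 1) * r = r ^ p := by
    rw [← Real.rpow_add_one' hr (by linarith)]
    ring_nf
  have hre : ((r : ℂ) * x * (starRingEnd ℂ) η).re = r * (x * (starRingEnd ℂ) η).re := by
    rw [mul_assoc, Complex.re_ofReal_mul]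
  unfold Cp
  rw [h, norm_mul, Complex.norm_of_nonneg hr, Real.mul_rpow hr (norm_nonneg x),
    Real.mul_rpow hr (norm_nonneg x), hre, hmul', ← hmul]
  ring

/-- The cross terms of the two `C_p`-functionals in the remainder cancel. -/
lemma Rp_succ_eq {p : ℝ} (hp : 1 < p) {φ : ℕ → ℝ} (u : ℕ → ℂ) {n : ℕ}
    (hn : 0 < φ n) (hmono : φ n ≤ φ (n + 1)) :
    Rp p φ u (n + 1) = ‖u (n + 1) - u n‖ ^ p
      - (φ (n + 1) - φ n) ^ (p - 1) / φ (n + 1) ^ (p - 1) * ‖u (n + 1)‖ ^ p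
      + (φ (n + 1) - φ n) ^ (p - 1) / φ n ^ (p - 1) * ‖u n‖ ^ p := by
  unfold Rp
  simp only [Nat.add_sub_cancel]
  generalize φ (n + 1) = b at *
  generalize φ n = a at *
  generalize u (n + 1) = x at *
  generalize u n = y at *
  have hb : 0 < b := hn.trans_le hmono
  have hd : 0 ≤ b - a := sub_nonneg.mpr hmono
  have ha' : (a : ℂ) ≠ 0 := by exact_mod_cast hn.ne'
  have hb' : (b : ℂ) ≠ 0 := by exact_mod_cast hb.ne'
  have hpow {c : ℝ} (hc : 0 < c) : c ^ p = c ^ (p - 1) * c := by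
    rw [← Real.rpow_add_one hc.ne']
    ring_nf
  have hA := Real.rpow_pos_of_pos hn (p - 1)
  have hB := Real.rpow_pos_of_pos hb (p - 1)
  rw [Cp_of_sub_eq_real_mul (x := x) (r := (b - a) / b) hp (by positivity)
      (by push_cast; field_simp; ring),
    Cp_of_sub_eq_real_mul (x := x) (r := b⁻¹) hp (by positivity)
      (by push_cast; field_simp; ring),
    norm_div, Complex.norm_of_nonneg hn.le, Real.div_rpow (norm_nonneg y) hn.le, hpow hn,
    Real.div_rpow hd hb.le, Real.inv_rpow hb.le]
  have hη : y / (a : ℂ) - x / (b : ℂ)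
      = ((-a⁻¹ : ℝ) : ℂ) * (((a / b : ℝ) : ℂ) * x - y) := by
    push_cast
    field_simp
    ring
  have hre : (x * (starRingEnd ℂ) (y / (a : ℂ) - x / (b : ℂ))).re
      = -a⁻¹ * (x * (starRingEnd ℂ) (((a / b : ℝ) : ℂ) * x - y)).re := by
    rw [hη, map_mul, Complex.conj_ofReal, mul_left_comm, Complex.re_ofReal_mul]
  rw [hre]
  field_simp
  ring

/-- General weighted discrete `p`-Hardy identity: equality holds when the
supersolution condition is satisfied with equality. -/
theorem general_weighted_discrete_p_hardy_identity
    (p : ℝ) (hp : 1 < p) (v w : ℕ → ℝ)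
    (hv : ∀ n, 1 ≤ n → 0 ≤ v n) (hw : ∀ n, 1 ≤ n → 0 ≤ w n)
    (φ : ℕ → ℝ) (hφ0 : φ 0 = 0) (hφpos : ∀ n, 1 ≤ n → 0 < φ n)
    (hφmono : ∀ n, 1 ≤ n → φ n ≤ φ (n + 1))
    (hcond : ∀ n, 1 ≤ n →
      v n * (φ n - φ (n - 1)) ^ (p - 1) - v (n + 1) * (φ (n + 1) - φ n) ^ (p - 1)
        = w n * φ n ^ (p - 1))
    (u : ℕ → ℂ) (hu : (Function.support u).Finite) (hu0 : u 0 = 0) :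
    ∑' n : ℕ, v (n + 1) * ‖u (n + 1) - u n‖ ^ p
      = (∑' n : ℕ, w (n + 1) * ‖u (n + 1)‖ ^ p)
          + (∑' n : ℕ, v (n + 2) * Rp p φ u (n + 2)) := by
  have hp0 : p ≠ 0 := by linarith
  obtain ⟨N, hN⟩ : ∃ N, ∀ n, N ≤ n → u n = 0 := by
    obtain ⟨M, hM⟩ := hu.bddAbove
    refine ⟨M + 1, fun n hn => by_contra fun h => ?_⟩
    have := hM (Function.mem_support.mpr h)
    omega
  have hR (n : ℕ) := Rp_succ_eq hp u (hφpos (n + 1) (by omega)) (hφmono (n + 1) (by omega))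
  set g : ℕ → ℝ := fun n =>
    v (n + 1) * ((φ (n + 1) - φ n) ^ (p - 1) / φ (n + 1) ^ (p - 1)) * ‖u (n + 1)‖ ^ p with hg
  have hstep (n : ℕ) : w (n + 1) * ‖u (n + 1)‖ ^ p + v (n + 2) * Rp p φ u (n + 2)
      = v (n + 2) * ‖u (n + 2) - u (n + 1)‖ ^ p - (g (n + 1) - g n) := by
    have hpos := Real.rpow_pos_of_pos (hφpos (n + 1) (by omega)) (p - 1)
    have hw_eq := eq_div_of_mul_eq hpos.ne' (hcond (n + 1) (by omega)).symm
    rw [hR n, hw_eq]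
    simp only [hg, Nat.add_sub_cancel]
    ring
  have hg_zero : g 0 = v 1 * ‖u 1 - u 0‖ ^ p := by
    have hpos := Real.rpow_pos_of_pos (hφpos 1 le_rfl) (p - 1)
    simp [hg, hφ0, hu0, div_self hpos.ne']
  have hgN : g N = 0 := by simp [hg, hN (N + 1) (by omega), Real.zero_rpow hp0]
  have hzero (n : ℕ) (hn : n ∉ Finset.range N) : N ≤ n := by simpa using hn
  rw [tsum_eq_sum (s := Finset.range (N + 1)), tsum_eq_sum (s := Finset.range N),
    tsum_eq_sum (s := Finset.range N), ← Finset.sum_add_distrib, Finset.sum_congr rfl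
    (fun n _ => hstep n), Finset.sum_sub_distrib, Finset.sum_range_sub, Finset.sum_range_succ',
    hgN, hg_zero]
  · ring
  · intro n hn
    have := hzero n hn
    rw [hR n, hN (n + 1) (by omega), hN (n + 1 + 1) (by omega)]
    simp [Real.zero_rpow hp0]
  · intro n hn
    have := hzero n hn
    simp [hN (n + 1) (by omega), Real.zero_rpow hp0]
  · intro n hn
    have hn' : N + 1 ≤ n := by simpa using hn
    simp [hN (n + 1) (by omega), hN n (by omega), Real.zero_rpow hp0]
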